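/- arXiv:2403.10999 — 3 statements merged into one kernel-verified Lean document; each statement's English description precedes it below -/
import Mathlib

section
/- Let D be a division ring with center F and let P(x) = (x − dₙ)⋯(x − d₁) ∈ D[x], where d₁, …, dₙ ∈ D and d₁, …, d_{n−1} are algebraic over F with minimal polynomials f₁(x), …, f_{n−1}(x) ∈ F[x]. For i = 1, …, n−1 let Sᵢ(x) ∈ D[x] be such that fᵢ(x) = Sᵢ(x)·(x − dᵢ). If the conjugacy classes [d₁], …, [dₙ] are pairwise distinct, then P(x) has exactly n roots ζ₁, …, ζₙ, given by ζₖ = Pₖ(dₖ)·dₖ·(Pₖ(dₖ))⁻¹ for k = 1, …, n, where Pₖ(x) = 1 if k = 1 and Pₖ(x) = S₁(x)⋯S_{k−1}(x) otherwise. In particular, the set of roots of P(x) equals {ζ₁, …, ζₙ}. -/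
open Polynomial

/-- The conjugacy class of `a` in a division ring. -/
def conjClass {D : Type*} [DivisionRing D] (a : D) : Set D :=
  {b | ∃ d : D, d ≠ 0 ∧ b = d * a * d⁻¹}

namespace Polynomial

variable {D : Type*} [DivisionRing D]

theorem eval_mul_of_semiconj {R : Type*} [Semiring R] (p q : R[X]) {c e : R}
    (h : q.eval c * c = e * q.eval c) : (p * q).eval c = p.eval e * q.eval c := by
  have hpow : ∀ n : ℕ, q.eval c * c ^ n = e ^ n * q.eval c := fun n =>
    (SemiconjBy.pow_right (show SemiconjBy (q.eval c) c e from h) n).eq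
  induction p using Polynomial.induction_on' with
  | add p₁ p₂ h₁ h₂ => simp [add_mul, h₁, h₂]
  | monomial n a =>
    rw [← C_mul_X_pow_eq_monomial, mul_assoc, eval_C_mul, X_pow_mul, eval_mul_X_pow, hpow,
      eval_C_mul, X_pow_eq_monomial, eval_monomial, one_mul, mul_assoc]

theorem eval_mul_of_eval_ne_zero (p q : D[X]) {c : D} (h : q.eval c ≠ 0) :
    (p * q).eval c = p.eval (q.eval c * c * (q.eval c)⁻¹) * q.eval c :=
  eval_mul_of_semiconj p q (by rw [inv_mul_cancel_right₀ h])

theorem eval_mul_eq_zero_of_right {R : Type*} [Semiring R] (p q : R[X]) {c : R}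
    (h : q.eval c = 0) : (p * q).eval c = 0 := by
  rw [eval_mul_of_semiconj (e := c) p q (by simp [h]), h, mul_zero]

theorem commute_map_center (G : (Subring.center D)[X]) (q : D[X]) :
    Commute (G.map (algebraMap (Subring.center D) D)) q := by
  induction G using Polynomial.induction_on' with
  | add p₁ p₂ h₁ h₂ => rw [Polynomial.map_add]; exact h₁.add_left h₂
  | monomial n a =>
    rw [map_monomial, ← C_mul_X_pow_eq_monomial]
    refine Commute.mul_left ?_ (commute_X_pow q n)
    ext i
    rw [coeff_C_mul, coeff_mul_C]
    exact Algebra.commutes a _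

theorem aeval_conj_of_center (G : (Subring.center D)[X]) (c : D) {u : D} (hu : u ≠ 0) :
    aeval (u * c * u⁻¹) G = u * aeval c G * u⁻¹ := by
  have h := congrArg (eval c) (commute_map_center G (C u)).eq
  rw [eval_mul_of_eval_ne_zero _ _ (by simpa using hu), eval_C_mul, eval_C] at h
  rw [eval_map_algebraMap, eval_map_algebraMap] at h
  rw [← h, mul_inv_cancel_right₀ hu]

theorem exists_center_lift_of_minimal_monic (p : D[X]) (hp : p.Monic) (b : D)
    (hb : ∀ c ∈ conjClass b, p.eval c = 0)
    (hmin : ∀ q : D[X], q.degree < p.degree → (∀ c ∈ conjClass b, q.eval c = 0) → q = 0) :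
    ∃ g : (Subring.center D)[X], g.map (algebraMap (Subring.center D) D) = p ∧
      g.degree = p.degree ∧ g.Monic := by
  refine lifts_and_degree_eq_and_monic ?_ hp
  have hcomm : ∀ u : D, C u * p = p * C u := by
    intro u
    by_cases hu : u = 0
    · simp [hu]
    rw [← sub_eq_zero]
    apply hmin
    · have hne : C u * p ≠ 0 := mul_ne_zero (by simpa using hu) hp.ne_zero
      have hd : (C u * p).degree = p.degree := by
        rw [degree_mul, degree_C hu, zero_add]
      rw [← hd]
      refine degree_sub_lt_left ?_ hne ?_
      · rw [hd, degree_mul, degree_C hu, add_zero]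
      · simp [leadingCoeff_mul, hp.leadingCoeff]
    · rintro c ⟨v, hv, rfl⟩
      have huv : u * v ≠ 0 := mul_ne_zero hu hv
      rw [eval_sub, eval_C_mul, hb _ ⟨v, hv, rfl⟩,
        eval_mul_of_eval_ne_zero _ _ (by simpa using hu), eval_C,
        hb _ ⟨u * v, huv, by simp [mul_assoc]⟩]
      simp
  rw [lifts_iff_coeff_lifts]
  intro i
  refine ⟨⟨p.coeff i, Subring.mem_center_iff.2 fun u => ?_⟩, rfl⟩
  simpa using congrArg (fun q => q.coeff i) (hcomm u)

theorem exists_center_monic_of_vanishing (s : D[X]) (hs : s ≠ 0) (b : D)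
    (hb : ∀ c ∈ conjClass b, s.eval c = 0) :
    ∃ g : (Subring.center D)[X], g.Monic ∧ aeval b g = 0 ∧ g.degree ≤ s.degree := by
  let V : Set D[X] := {p | p ≠ 0 ∧ ∀ c ∈ conjClass b, p.eval c = 0}
  obtain ⟨p, ⟨hp0, hpb⟩, hmin⟩ :=
    (measure (natDegree (R := D))).wf.has_min V ⟨s, hs, hb⟩
  have hmin' : ∀ q ∈ V, p.degree ≤ q.degree := fun q hq => by
    rw [degree_eq_natDegree hp0, degree_eq_natDegree hq.1]
    exact_mod_cast not_lt.1 (hmin q hq)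
  have hlc : p.leadingCoeff⁻¹ ≠ 0 := inv_ne_zero (leadingCoeff_ne_zero.2 hp0)
  have hd : (C p.leadingCoeff⁻¹ * p).degree = p.degree := by
    rw [degree_mul, degree_C hlc, zero_add]
  have hpb' : ∀ c ∈ conjClass b, (C p.leadingCoeff⁻¹ * p).eval c = 0 := fun c hc => by
    rw [eval_C_mul, hpb c hc, mul_zero]
  obtain ⟨g, hg, hgd, hgm⟩ := exists_center_lift_of_minimal_monic (C p.leadingCoeff⁻¹ * p)
    (by simp [Monic, leadingCoeff_mul, leadingCoeff_ne_zero.2 hp0]) b hpb'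
    (fun q hq hqb => by
      by_contra hq0
      exact absurd (hmin' q ⟨hq0, hqb⟩) (not_le.2 (hd ▸ hq)))
  refine ⟨g, hgm, ?_, ?_⟩
  · rw [← eval_map_algebraMap, hg]
    exact hpb' b ⟨1, one_ne_zero, by simp⟩
  · rw [hgd, hd]
    exact hmin' s ⟨hs, hb⟩

theorem mem_conjClass_of_aeval_minpoly_eq_zero {a b : D} (ha : IsIntegral (Subring.center D) a)
    (S : D[X])
    (hS : (minpoly (Subring.center D) a).map (algebraMap (Subring.center D) D) = S * (X - C a))
    (hb : aeval b (minpoly (Subring.center D) a) = 0) : b ∈ conjClass a := by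
  by_contra hba
  have hXa : (X - C a : D[X]) ≠ 0 := X_sub_C_ne_zero a
  have hS0 : S ≠ 0 := by
    rintro rfl
    exact ((minpoly.monic ha).map (algebraMap (Subring.center D) D)).ne_zero (by simpa using hS)
  have hcomm : (X - C a) * S = S * (X - C a) := by
    apply mul_right_cancel₀ hXa
    rw [mul_assoc, ← hS]
    exact (commute_map_center _ _).eq.symm
  have hvan : ∀ c ∈ conjClass b, S.eval c = 0 := by
    rintro c ⟨u, hu, rfl⟩
    by_contra hc
    have h0 : ((X - C a) * S).eval (u * b * u⁻¹) = 0 := by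
      rw [hcomm, ← hS, eval_map_algebraMap, aeval_conj_of_center _ _ hu, hb]
      simp
    rw [eval_mul_of_eval_ne_zero _ _ hc] at h0
    have h1 := (mul_eq_zero.1 h0).resolve_right hc
    rw [eval_sub, eval_X, eval_C, sub_eq_zero] at h1
    generalize S.eval (u * b * u⁻¹) = w at hc h1
    exact hba ⟨(w * u)⁻¹, inv_ne_zero (mul_ne_zero hc hu), by
      rw [← h1]; simp [mul_assoc, hc, hu]⟩
  obtain ⟨g, hgm, hgb, hgd⟩ := exists_center_monic_of_vanishing S hS0 b hvan
  have heq : minpoly (Subring.center D) a = minpoly (Subring.center D) b :=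
    minpoly.eq_of_irreducible_of_monic (minpoly.irreducible ha) hb (minpoly.monic ha)
  have hle := minpoly.min (Subring.center D) b hgm hgb
  rw [← heq, ← degree_map_eq_of_injective
    (FaithfulSMul.algebraMap_injective (Subring.center D) D), hS, degree_mul, degree_X_sub_C] at hle
  have h2 := hle.trans hgd
  rw [degree_eq_natDegree hS0] at h2
  norm_cast at h2
  omega

/-- The product `(X - d (m - 1)) ⋯ (X - d 0)`. -/
noncomputable def linearProd (d : ℕ → D) (m : ℕ) : D[X] :=
  ((List.range m).map fun i => X - C (d i)).reverse.prod

theorem linearProd_succ (d : ℕ → D) (m : ℕ) :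
    linearProd d (m + 1) = (X - C (d m)) * linearProd d m := by
  simp [linearProd, List.range_succ]

theorem exists_linearProd_eq_mul (d : ℕ → D) {k m : ℕ} (h : k ≤ m) :
    ∃ A, linearProd d m = A * linearProd d k := by
  induction m, h using Nat.le_induction with
  | base => exact ⟨1, by simp⟩
  | succ m _ ih =>
    obtain ⟨A, hA⟩ := ih
    exact ⟨(X - C (d m)) * A, by rw [linearProd_succ, hA, mul_assoc]⟩

theorem exists_first_linearProd_eval_eq_zero (d : ℕ → D) (m : ℕ) (r : D)
    (h : (linearProd d m).eval r = 0) :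
    ∃ k < m, (linearProd d k).eval r ≠ 0 ∧ (linearProd d (k + 1)).eval r = 0 := by
  induction m with
  | zero => simp [linearProd] at h
  | succ m ih =>
    by_cases hm : (linearProd d m).eval r = 0
    · obtain ⟨k, hk, hk'⟩ := ih hm
      exact ⟨k, by omega, hk'⟩
    · exact ⟨m, by omega, hm, h⟩

theorem exists_center_eq_prod_mul_linearProd (d : ℕ → D) (S : ℕ → D[X]) (m : ℕ)
    (halg : ∀ i < m, IsIntegral (Subring.center D) (d i))
    (hS : ∀ i < m, (minpoly (Subring.center D) (d i)).map (algebraMap (Subring.center D) D) =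
      S i * (X - C (d i))) :
    ∃ G : (Subring.center D)[X],
      G.map (algebraMap (Subring.center D) D) = ((List.range m).map S).prod * linearProd d m ∧
      ∀ r : D, (∀ i < m, r ∉ conjClass (d i)) → aeval r G ≠ 0 := by
  induction m with
  | zero => exact ⟨1, by simp [linearProd]⟩
  | succ m ih =>
    obtain ⟨G, hG, hr⟩ := ih (fun i hi => halg i (by omega)) (fun i hi => hS i (by omega))
    refine ⟨minpoly (Subring.center D) (d m) * G, ?_, fun r h => ?_⟩
    · rw [Polynomial.map_mul, hG, linearProd_succ, ← mul_assoc, (commute_map_center _ _).eq,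
        hS m (by omega)]
      simp [List.range_succ, mul_assoc]
    · rw [map_mul]
      refine mul_ne_zero (fun h0 => h m (by omega) ?_) (hr r fun i hi => h i (by omega))
      exact mem_conjClass_of_aeval_minpoly_eq_zero (halg m (by omega)) _ (hS m (by omega)) h0

theorem eval_ne_zero_of_center_eq_mul {T Q : D[X]} {G : (Subring.center D)[X]}
    (hG : G.map (algebraMap (Subring.center D) D) = T * Q) {a : D} (ha : aeval a G ≠ 0) :
    T.eval a ≠ 0 := by
  intro h
  have hQ : Q ≠ 0 := by
    rintro rfl
    rw [mul_zero] at hG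
    rw [← eval_map_algebraMap, hG, eval_zero] at ha
    exact ha rfl
  have hcomm : Q * T = T * Q := by
    apply mul_right_cancel₀ hQ
    rw [mul_assoc, ← hG]
    exact (commute_map_center _ _).eq.symm
  rw [← eval_map_algebraMap, hG, ← hcomm] at ha
  exact ha (eval_mul_eq_zero_of_right Q T h)

theorem eval_X_sub_C_mul_conj_eq_zero {T Q : D[X]} {G : (Subring.center D)[X]}
    (hG : G.map (algebraMap (Subring.center D) D) = T * Q) {a : D} (ha : aeval a G ≠ 0) :
    ((X - C a) * Q).eval (T.eval a * a * (T.eval a)⁻¹) = 0 := by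
  have hT := eval_ne_zero_of_center_eq_mul hG ha
  have hT0 : T ≠ 0 := by rintro rfl; simp at hT
  have hcomm : Q * T = T * Q := by
    apply mul_left_cancel₀ hT0
    rw [← mul_assoc, ← hG]
    exact (commute_map_center _ _).eq
  have h : ((X - C a) * Q * T).eval a = 0 := by
    rw [mul_assoc, hcomm, ← hG, ← (commute_map_center G _).eq]
    exact eval_mul_eq_zero_of_right _ _ (by simp)
  rw [eval_mul_of_eval_ne_zero _ _ hT] at h
  exact (mul_eq_zero.1 h).resolve_right hT

theorem eq_conj_of_eval_X_sub_C_mul_eq_zero {T Q : D[X]} {G : (Subring.center D)[X]}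
    (hG : G.map (algebraMap (Subring.center D) D) = T * Q) {a r : D} (ha : aeval a G ≠ 0)
    (hQ : Q.eval r ≠ 0) (hr : ((X - C a) * Q).eval r = 0) :
    r = T.eval a * a * (T.eval a)⁻¹ := by
  have hT := eval_ne_zero_of_center_eq_mul hG ha
  rw [eval_mul_of_eval_ne_zero _ _ hQ] at hr
  have hra := (mul_eq_zero.1 hr).resolve_right hQ
  rw [eval_sub, eval_X, eval_C, sub_eq_zero] at hra
  have hGr : aeval r G = T.eval a * Q.eval r := by
    rw [← eval_map_algebraMap, hG, eval_mul_of_eval_ne_zero _ _ hQ, hra]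
  have hcomm : aeval r G * r = r * aeval r G := by
    simpa using congrArg (aeval r) (X_mul (p := G)).symm
  rw [hGr] at hcomm
  rw [eq_mul_inv_iff_mul_eq₀ hT]
  apply mul_right_cancel₀ hQ
  rw [mul_assoc, ← hcomm, ← hra]
  simp [mul_assoc, hQ]

end Polynomial

theorem conjClass_eq_of_mem {D : Type*} [DivisionRing D] {a b : D} (h : b ∈ conjClass a) :
    conjClass b = conjClass a := by
  obtain ⟨u, hu, rfl⟩ := h
  ext c
  constructor
  · rintro ⟨v, hv, rfl⟩
    exact ⟨v * u, mul_ne_zero hv hu, by simp [mul_assoc]⟩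
  · rintro ⟨v, hv, rfl⟩
    exact ⟨v * u⁻¹, mul_ne_zero hv (inv_ne_zero hu), by simp [mul_assoc, hu]⟩

theorem Fin.exists_natExtension {α : Type*} [Nonempty α] {n : ℕ} (f : Fin n → α) :
    ∃ g : ℕ → α, f = fun i : Fin n => g i :=
  ⟨fun i => if h : i < n then f ⟨i, h⟩ else Classical.arbitrary α, by ext i; simp⟩

theorem List.ofFn_eq_map_range {α : Type*} (g : ℕ → α) (m : ℕ) :
    List.ofFn (fun i : Fin m => g i) = (List.range m).map g := by
  apply List.ext_getElem <;> simp

/-- **Theorem (explicit roots of a product of linear factors over a division ring).**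
Let `D` be a division ring with center `F`, `P(x) = (x − dₙ)⋯(x − d₁) ∈ D[x]`, where
`d₁, …, dₙ₋₁` are algebraic over `F` with minimal polynomials `fᵢ`, and let
`Sᵢ(x) ∈ D[x]` satisfy `fᵢ(x) = Sᵢ(x)·(x − dᵢ)`.  If the conjugacy classes `[dₖ]` are
pairwise distinct, then `P` has exactly `n` roots `ζₖ = Pₖ(dₖ) dₖ (Pₖ(dₖ))⁻¹`, where
`P₁ = 1` and `Pₖ = S₁(x)⋯Sₖ₋₁(x)` otherwise; i.e. the set of roots of `P` equals
`{ζ₁, …, ζₙ}` and the `ζₖ` are pairwise distinct. -/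
theorem roots_of_linear_factors_formula {D : Type*} [DivisionRing D]
    (n : ℕ) (d : Fin n → D)
    (halg : ∀ i : Fin n, (i : ℕ) < n - 1 → IsIntegral (Subring.center D) (d i))
    (S : Fin n → Polynomial D)
    (hS : ∀ i : Fin n, (i : ℕ) < n - 1 →
      (minpoly (Subring.center D) (d i)).map (algebraMap (Subring.center D) D)
        = S i * (X - C (d i)))
    (hdist : ∀ i j : Fin n, i ≠ j → conjClass (d i) ≠ conjClass (d j))
    (P : Polynomial D)
    (hP : P = ((List.ofFn fun i : Fin n => X - C (d i)).reverse).prod)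
    (Pk : Fin n → Polynomial D)
    (hPk : ∀ k : Fin n,
      Pk k = (List.ofFn fun i : Fin k => S ⟨i, i.isLt.trans k.isLt⟩).prod)
    (ζ : Fin n → D)
    (hζ : ∀ k : Fin n, ζ k = (Pk k).eval (d k) * d k * ((Pk k).eval (d k))⁻¹) :
    Function.Injective ζ ∧ {r : D | P.eval r = 0} = Set.range ζ := by
  obtain ⟨d, rfl⟩ := Fin.exists_natExtension d
  obtain ⟨S, rfl⟩ := Fin.exists_natExtension S
  have hP' : P = linearProd d n := by
    rw [hP, List.ofFn_eq_map_range (fun i => X - C (d i)), linearProd]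
  have hPk' : ∀ k : Fin n, Pk k = ((List.range k).map S).prod := fun k => by
    rw [hPk, ← List.ofFn_eq_map_range]
  have hcenter : ∀ k : Fin n, ∃ G : (Subring.center D)[X],
      G.map (algebraMap (Subring.center D) D) = Pk k * linearProd d k ∧
        aeval (d k) G ≠ 0 := by
    intro k
    obtain ⟨G, hG, hne⟩ := exists_center_eq_prod_mul_linearProd d S k
      (fun i hi => halg ⟨i, by omega⟩ (by simp; omega))
      (fun i hi => hS ⟨i, by omega⟩ (by simp; omega))
    refine ⟨G, by rw [hPk', hG], hne _ fun i hi hmem => ?_⟩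
    exact hdist k ⟨i, by omega⟩ (by rw [Ne, Fin.ext_iff]; simp; omega) (conjClass_eq_of_mem hmem)
  have hmem : ∀ k : Fin n, ζ k ∈ conjClass (d k) := fun k => by
    obtain ⟨G, hG, hne⟩ := hcenter k
    exact ⟨_, eval_ne_zero_of_center_eq_mul hG hne, hζ k⟩
  refine ⟨fun i j hij => ?_, Set.ext fun r => ⟨fun hr => ?_, ?_⟩⟩
  · by_contra hne
    exact hdist i j hne
      ((conjClass_eq_of_mem (hmem i)).symm.trans (hij ▸ conjClass_eq_of_mem (hmem j)))
  · obtain ⟨k, hk, hk₀, hk₁⟩ := exists_first_linearProd_eval_eq_zero d n r (hP' ▸ hr)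
    obtain ⟨G, hG, hne⟩ := hcenter ⟨k, hk⟩
    rw [linearProd_succ] at hk₁
    exact ⟨⟨k, hk⟩, (hζ _).trans (eq_conj_of_eval_X_sub_C_mul_eq_zero hG hne hk₀ hk₁).symm⟩
  · rintro ⟨k, rfl⟩
    obtain ⟨G, hG, hne⟩ := hcenter k
    obtain ⟨A, hA⟩ := exists_linearProd_eq_mul d (Nat.succ_le_of_lt k.isLt)
    rw [Set.mem_ofPred_eq, hP', hA, Nat.succ_eq_add_one, linearProd_succ, hζ]
    exact eval_mul_eq_zero_of_right _ _ (eval_X_sub_C_mul_conj_eq_zero hG hne)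
end

section
/- Let D be a noncommutative division ring, let a ∈ D and let t ∈ D be an element that does not commute with a. Set q := tat⁻¹, b := (q − a)·q·(q − a)⁻¹ and b₁ := (q − a)·q·(q − a)⁻¹ computed with q = tat⁻¹, i.e. b₁ = (tat⁻¹ − a)·tat⁻¹·(tat⁻¹ − a)⁻¹. If d ∈ D is another element not commuting with a, set b := (dad⁻¹ − a)·dad⁻¹·(dad⁻¹ − a)⁻¹. If b ≠ b₁, then the polynomials (x − b)(x − a) and (x − b₁)(x − a) in D[x] each have infinitely many roots in the conjugacy class [a], and a is the unique common root of these two polynomials. -/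
open Polynomial

theorem finite_ker_mul {R M : Type*} [Ring R] [AddCommGroup M] [Module R M]
    {f g : Module.End R M} (hf : {x | f x = 0}.Finite) (hg : {x | g x = 0}.Finite) :
    {x | (f * g) x = 0}.Finite := by
  refine (hf.preimage' (f := g) fun y _ => ?_)
  rcases Set.eq_empty_or_nonempty (g ⁻¹' {y}) with h | ⟨x₀, hx₀⟩
  · simp [h]
  · refine (hg.image (fun x => x + x₀)).subset fun x hx => ⟨x - x₀, ?_, by simp⟩
    simp only [Set.mem_preimage, Set.mem_singleton_iff] at hx hx₀
    simp [hx, hx₀]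

/-- An eigenspace of right multiplication by `a` is at most one-dimensional over the
centralizer of `a`. -/
theorem finite_setOf_mul_eq_mul {D : Type*} [DivisionRing D] {a : D}
    (h : (Subring.centralizer {a} : Set D).Finite) (l : D) :
    {x : D | x * a = l * x}.Finite := by
  by_cases hx : ∃ x₀ : D, x₀ ≠ 0 ∧ x₀ * a = l * x₀
  · obtain ⟨x₀, h0, hx₀⟩ := hx
    refine (h.image (x₀ * ·)).subset fun x hx => ⟨x₀⁻¹ * x, ?_, by simp [h0]⟩
    simp only [Set.mem_ofPred_eq] at hx
    simp only [SetLike.mem_coe, Subring.mem_centralizer_iff, Set.mem_singleton_iff, forall_eq]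
    apply mul_left_cancel₀ h0
    rw [← mul_assoc, hx₀, mul_assoc, mul_inv_cancel_left₀ h0, mul_assoc, mul_inv_cancel_left₀ h0,
      hx]
  · push Not at hx
    refine (Set.finite_singleton (0 : D)).subset fun x h => ?_
    by_contra h'
    exact hx x h' h

/-- A division ring with a finite centralizer is finite. -/
theorem finite_of_finite_centralizer {D : Type*} [DivisionRing D] {a : D}
    (h : (Subring.centralizer {a} : Set D).Finite) : Finite D := by
  let K := Subring.centralizer {a}
  have : Finite K := h
  let : Field K := (Finite.isDomain_to_isField K).toField
  let : Fintype K := Fintype.ofFinite K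
  let T : Module.End K D :=
    { toFun := fun x => x * a
      map_add' := fun x y => add_mul x y a
      map_smul' := fun c x => by simp [Subring.smul_def, mul_assoc] }
  have hpow (n : ℕ) (x : D) : (T ^ n) x = x * a ^ n := by
    induction n with
    | zero => simp
    | succ n ih => rw [pow_succ', Module.End.mul_apply, ih, pow_succ, ← mul_assoc]; rfl
  have hker (s : Finset K) : {x | aeval T (∏ l ∈ s, (X - C l)) x = 0}.Finite := by
    classical
    induction s using Finset.induction_on with
    | empty => simp
    | insert l s hl ih =>
      rw [Finset.prod_insert hl, map_mul]
      refine finite_ker_mul ?_ ih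
      refine (finite_setOf_mul_eq_mul h (l : D)).subset fun x hx => ?_
      simpa [T, sub_eq_zero, Module.algebraMap_end_apply, Subring.smul_def] using hx
  have haK : a ∈ K := by simp [K, Subring.mem_centralizer_iff]
  have hacard : a ^ Fintype.card K = a :=
    congrArg Subtype.val (FiniteField.pow_card (⟨a, haK⟩ : K))
  have hprod : ∏ l : K, (X - C l) = X ^ Fintype.card K - X := by
    have hmonic : (X ^ Fintype.card K - X : K[X]).Monic :=
      monic_X_pow_sub (degree_X.trans_lt (by exact_mod_cast Fintype.one_lt_card))
    have := prod_multiset_X_sub_C_of_monic_of_roots_card_eq hmonic (by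
      rw [FiniteField.roots_X_pow_card_sub_X,
        FiniteField.X_pow_card_sub_X_natDegree_eq K Fintype.one_lt_card, Finset.card_val,
        Finset.card_univ])
    rwa [FiniteField.roots_X_pow_card_sub_X] at this
  have := hker Finset.univ
  rw [hprod] at this
  refine Set.finite_univ_iff.mp (this.subset fun x _ => ?_)
  simp [hpow, hacard, T]

theorem infinite_centralizer {D : Type*} [DivisionRing D] {a d : D} (hd : d * a ≠ a * d) :
    (Subring.centralizer {a} : Set D).Infinite := fun h => by
  have := finite_of_finite_centralizer h
  exact hd ((Finite.isDomain_to_isField D).mul_comm d a)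

theorem eval_X_sub_C_mul_X_sub_C {R : Type*} [Ring R] (a b r : R) :
    ((X - C b) * (X - C a)).eval r = (r - a) * r - b * (r - a) := by
  have : (X - C b) * (X - C a) = (X - C a) * X - C b * (X - C a) := by
    rw [sub_mul, X_mul]
  rw [this, eval_sub, eval_mul_X, eval_C_mul]
  simp

/-- The conjugate of `a` by `v` is a root of `(X - b)(X - a)` exactly when a condition additive
in `v` holds. -/
theorem eval_conj_eq_zero_iff {D : Type*} [DivisionRing D] (a b : D) {v : D} (hv : v ≠ 0) :
    ((X - C b) * (X - C a)).eval (v * a * v⁻¹) = 0 ↔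
      (v * a - a * v) * a = b * (v * a - a * v) := by
  rw [eval_X_sub_C_mul_X_sub_C, ← mul_left_inj' hv, zero_mul, ← sub_eq_zero (b := b * _)]
  simp [sub_mul, mul_sub, mul_assoc, hv]

theorem infinite_roots_conjClass {D : Type*} [DivisionRing D] {a b d : D}
    (hd : d * a ≠ a * d)
    (hb : b = (d * a * d⁻¹ - a) * (d * a * d⁻¹) * (d * a * d⁻¹ - a)⁻¹) :
    {r : D | r ∈ conjClass a ∧ ((X - C b) * (X - C a)).eval r = 0}.Infinite := by
  have hd0 : d ≠ 0 := by rintro rfl; simp at hd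
  have hq : d * a * d⁻¹ - a ≠ 0 := by
    rwa [sub_ne_zero, ne_eq, mul_inv_eq_iff_eq_mul₀ hd0]
  have hdroot : (d * a - a * d) * a = b * (d * a - a * d) := by
    rw [← eval_conj_eq_zero_iff a b hd0, eval_X_sub_C_mul_X_sub_C, hb, inv_mul_cancel_right₀ hq,
      sub_self]
  have hcomm {c : D} (hc : c ∈ (Subring.centralizer {a} : Set D)) : Commute a c := by
    simpa [Set.mem_centralizer_iff, commute_iff_eq] using hc
  have hne {c : D} (hc : c ∈ (Subring.centralizer {a} : Set D)) : c + d ≠ 0 := fun h => by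
    rw [eq_neg_of_add_eq_zero_right h] at hd
    simp [(hcomm hc).eq] at hd
  refine ((infinite_centralizer hd).image (f := fun c => (c + d) * a * (c + d)⁻¹) ?_).mono ?_
  · intro c hc c' hc' h
    have hv := hne hc
    have hv' := hne hc'
    dsimp only at h
    obtain ⟨e, he⟩ : ∃ e, c' + d = (c + d) * e := ⟨_, (mul_inv_cancel_left₀ hv _).symm⟩
    have hae : Commute a e := by
      apply mul_left_cancel₀ hv
      rw [eq_mul_inv_iff_mul_eq₀ hv', he, ← mul_assoc, inv_mul_cancel_right₀ hv] at h
      rwa [← mul_assoc, ← mul_assoc]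
    have hde : d * (e - 1) = c' - c * e := by
      rw [mul_sub, mul_one, sub_eq_sub_iff_add_eq_add, he]
      noncomm_ring
    by_cases he1 : e - 1 = 0
    · simpa [sub_eq_zero.mp he1, eq_comm] using he
    · have h' : Commute a d := by
        rw [← mul_inv_cancel_right₀ he1 d, hde]
        exact ((hcomm hc').sub_right ((hcomm hc).mul_right hae)).mul_right
          (hae.sub_right (Commute.one_right a)).inv_right₀
      exact absurd h'.symm.eq hd
  · rintro _ ⟨c, hc, rfl⟩
    refine ⟨⟨c + d, hne hc, rfl⟩, (eval_conj_eq_zero_iff a b (hne hc)).2 ?_⟩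
    have : (c + d) * a - a * (c + d) = d * a - a * d := by
      rw [add_mul, mul_add, (hcomm hc).eq]; abel
    rw [this, hdroot]

/-- **Remark (two quadratics with many roots in a class sharing a unique root).**
Let `D` be a noncommutative division ring, `a ∈ D`, and let `t, d ∈ D` not commute with
`a`.  With `b₁ := (t a t⁻¹ − a)·(t a t⁻¹)·(t a t⁻¹ − a)⁻¹` and
`b := (d a d⁻¹ − a)·(d a d⁻¹)·(d a d⁻¹ − a)⁻¹`, if `b ≠ b₁` then the polynomials
`(x − b)(x − a)` and `(x − b₁)(x − a)` each have infinitely many roots in `[a]`, and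
`a` is their unique common root. -/
theorem two_quadratics_unique_common_root {D : Type*} [DivisionRing D]
    (a t d : D) (ht : t * a ≠ a * t) (hd : d * a ≠ a * d)
    (b₁ b : D)
    (hb₁ : b₁ = (t * a * t⁻¹ - a) * (t * a * t⁻¹) * (t * a * t⁻¹ - a)⁻¹)
    (hb : b = (d * a * d⁻¹ - a) * (d * a * d⁻¹) * (d * a * d⁻¹ - a)⁻¹)
    (hne : b ≠ b₁) :
    {r : D | r ∈ conjClass a ∧ ((X - C b) * (X - C a)).eval r = 0}.Infinite ∧
    {r : D | r ∈ conjClass a ∧ ((X - C b₁) * (X - C a)).eval r = 0}.Infinite ∧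
    (∀ r : D, (((X - C b) * (X - C a)).eval r = 0 ∧
        ((X - C b₁) * (X - C a)).eval r = 0) ↔ r = a) := by
  refine ⟨infinite_roots_conjClass hd hb, infinite_roots_conjClass ht hb₁, fun r => ⟨?_, ?_⟩⟩
  · simp only [eval_X_sub_C_mul_X_sub_C, sub_eq_zero]
    rintro ⟨h, h₁⟩
    by_contra hr
    exact hne (mul_right_cancel₀ (sub_ne_zero.2 hr) (h.symm.trans h₁))
  · rintro rfl
    simp [eval_X_sub_C_mul_X_sub_C]
end

section
/- Let D be a division ring and let P(x) ∈ D[x] be a nonzero polynomial of degree n. Then the roots of P(x) in D lie in at most n conjugacy classes of D. Moreover, if P(x) = (x − a₁)⋯(x − aₙ) with a₁, …, aₙ ∈ D, then every root of P(x) is conjugate to some aᵢ. -/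
open Polynomial

theorem mem_conjClass_self {D : Type*} [DivisionRing D] (a : D) : a ∈ conjClass a :=
  ⟨1, one_ne_zero, by simp⟩

theorem mem_conjClass_of_conj_mem {D : Type*} [DivisionRing D] {a r d : D} (hd : d ≠ 0)
    (h : d * r * d⁻¹ ∈ conjClass a) : r ∈ conjClass a := by
  obtain ⟨e, he, h⟩ := h
  refine ⟨d⁻¹ * e, mul_ne_zero (inv_ne_zero hd) he, ?_⟩
  calc r = d⁻¹ * (d * r * d⁻¹) * d := by simp [mul_assoc, hd]
    _ = d⁻¹ * e * a * (d⁻¹ * e)⁻¹ := by rw [h]; simp [mul_assoc]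

/-- The product formula for evaluation over a division ring. -/
theorem eval_mul_eq_eval_conj_mul {D : Type*} [DivisionRing D] (F G : D[X]) (r : D)
    (hG : G.eval r ≠ 0) :
    (F * G).eval r = F.eval (G.eval r * r * (G.eval r)⁻¹) * G.eval r := by
  induction F using Polynomial.induction_on' with
  | add p q hp hq => simp only [add_mul, eval_add, hp, hq]
  | monomial n b =>
    have hconj : (G.eval r * r * (G.eval r)⁻¹) ^ n = G.eval r * r ^ n * (G.eval r)⁻¹ := by
      induction n with
      | zero => simp [hG]
      | succ k ih =>
        rw [pow_succ, ih, pow_succ]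
        simp [mul_assoc, hG]
    rw [← C_mul_X_pow_eq_monomial, mul_assoc, X_pow_mul, eval_C_mul, eval_mul_X_pow,
      C_mul_X_pow_eq_monomial, eval_monomial, hconj]
    simp [mul_assoc, hG]

/-- Division with remainder by `X - C a`, with the divisor on the right. -/
theorem exists_eq_mul_X_sub_C_add_C_eval {R : Type*} [Ring R] (P : R[X]) (a : R) :
    ∃ Q : R[X], P = Q * (X - C a) + C (P.eval a) := by
  induction P using Polynomial.induction_on' with
  | add p q hp hq =>
    obtain ⟨Q₁, h₁⟩ := hp
    obtain ⟨Q₂, h₂⟩ := hq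
    refine ⟨Q₁ + Q₂, ?_⟩
    rw [eval_add, C_add, add_mul, add_add_add_comm, ← h₁, ← h₂]
  | monomial n b =>
    refine ⟨C b * ∑ i ∈ Finset.range n, X ^ i * C a ^ (n - 1 - i), ?_⟩
    rw [mul_assoc, (commute_X (C a)).geom_sum₂_mul n, eval_monomial, C_mul, C_pow, mul_sub,
      sub_add_cancel, C_mul_X_pow_eq_monomial]

theorem exists_finset_roots_mem_conjClass {D : Type*} [DivisionRing D]
    (n : ℕ) (P : D[X]) (hP : P ≠ 0) (hdeg : P.natDegree = n) :
    ∃ s : Finset D, s.card ≤ n ∧ ∀ r : D, P.eval r = 0 → ∃ c ∈ s, r ∈ conjClass c := by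
  classical
  induction n generalizing P with
  | zero =>
    refine ⟨∅, by simp, fun r hr => ?_⟩
    rw [eq_C_of_natDegree_eq_zero hdeg, eval_C] at hr
    exact absurd (by rw [eq_C_of_natDegree_eq_zero hdeg, hr, C_0]) hP
  | succ n ih =>
    by_cases hroot : ∃ a, P.eval a = 0
    · obtain ⟨a, ha⟩ := hroot
      obtain ⟨Q, hQ⟩ := exists_eq_mul_X_sub_C_add_C_eval P a
      rw [ha, C_0, add_zero] at hQ
      have hQ0 : Q ≠ 0 := by
        rintro rfl
        exact hP (by rw [hQ, zero_mul])
      have hQdeg : Q.natDegree = n := by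
        rw [hQ, natDegree_mul hQ0 (X_sub_C_ne_zero a), natDegree_X_sub_C] at hdeg
        omega
      obtain ⟨s, hs, h⟩ := ih Q hQ0 hQdeg
      refine ⟨insert a s, (Finset.card_insert_le a s).trans (by omega), fun r hr => ?_⟩
      by_cases hra : (X - C a).eval r = 0
      · rw [eval_sub, eval_X, eval_C, sub_eq_zero] at hra
        exact ⟨a, Finset.mem_insert_self a s, hra ▸ mem_conjClass_self r⟩
      · rw [hQ, eval_mul_eq_eval_conj_mul _ _ _ hra, mul_eq_zero_iff_right hra] at hr
        obtain ⟨c, hc, hrc⟩ := h _ hr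
        exact ⟨c, Finset.mem_insert_of_mem hc, mem_conjClass_of_conj_mem hra hrc⟩
    · exact ⟨∅, by simp, fun r hr => absurd ⟨r, hr⟩ hroot⟩

theorem exists_mem_conjClass_of_eval_prod_eq_zero {D : Type*} [DivisionRing D] (l : List D)
    (r : D) (hr : (l.map fun a => X - C a).prod.eval r = 0) : ∃ a ∈ l, r ∈ conjClass a := by
  induction l with
  | nil => simp at hr
  | cons a l ih =>
    by_cases hl : (l.map fun a => X - C a).prod.eval r = 0
    · obtain ⟨b, hb, hrb⟩ := ih hl
      exact ⟨b, List.mem_cons_of_mem a hb, hrb⟩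
    · rw [List.map_cons, List.prod_cons, eval_mul_eq_eval_conj_mul _ _ _ hl,
        mul_eq_zero_iff_right hl, eval_sub, eval_X, eval_C, sub_eq_zero] at hr
      exact ⟨a, List.mem_cons_self, mem_conjClass_of_conj_mem hl (hr ▸ mem_conjClass_self _)⟩

/-- **Theorem (Gordon–Motzkin).**
Let `D` be a division ring and `P(x) ∈ D[x]` a nonzero polynomial of degree `n`.  Then
the roots of `P` in `D` lie in at most `n` conjugacy classes of `D`.  Moreover, if
`P(x) = (x − a₁)⋯(x − aₙ)` with `a₁, …, aₙ ∈ D`, then every root of `P` is conjugate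
to some `aᵢ`. -/
theorem gordon_motzkin {D : Type*} [DivisionRing D]
    (n : ℕ) (P : Polynomial D) (hP : P ≠ 0) (hdeg : P.natDegree = n) :
    (∃ s : Finset D, s.card ≤ n ∧
      ∀ r : D, P.eval r = 0 → ∃ c ∈ s, r ∈ conjClass c) ∧
    ∀ a : Fin n → D, P = (List.ofFn fun i : Fin n => X - C (a i)).prod →
      ∀ r : D, P.eval r = 0 → ∃ i : Fin n, r ∈ conjClass (a i) := by
  refine ⟨exists_finset_roots_mem_conjClass n P hP hdeg, fun a hPa r hr => ?_⟩
  have hlist : (List.ofFn fun i => X - C (a i)) = (List.ofFn a).map fun b => X - C b := by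
    rw [List.map_ofFn]
    rfl
  rw [hPa, hlist] at hr
  obtain ⟨b, hb, hrb⟩ := exists_mem_conjClass_of_eval_prod_eq_zero _ r hr
  obtain ⟨i, rfl⟩ := List.mem_ofFn.mp hb
  exact ⟨i, hrb⟩
end
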